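/- Let f : ℝ³ → ℂ be integrable with support in a ball B_R of radius R. Suppose D ≥ 1 and P is a polynomial on ℝ³ of degree at most D. Then the number of connected components of ℝ³ \ Z(P), where Z(P) is the zero set of P, is at most C·D³ for an absolute constant C. -/

import Mathlib

namespace MvPolynomial

/-- The partial derivative of a polynomial computes the derivative along a coordinate line. -/
theorem hasDerivAt_eval_update {σ : Type*} [DecidableEq σ] (p : MvPolynomial σ ℝ) (y : σ → ℝ)
    (i : σ) (t : ℝ) :
    HasDerivAt (fun s ↦ eval (Function.update y i s) p)
      (eval (Function.update y i t) (pderiv i p)) t := by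
  induction p using MvPolynomial.induction_on with
  | C a => simpa using hasDerivAt_const t a
  | add p q hp hq => simpa only [map_add] using hp.fun_add hq
  | mul_X p j hp =>
    have hX : HasDerivAt (fun s ↦ Function.update y i s j)
        (eval (Function.update y i t) (pderiv i (X j : MvPolynomial σ ℝ))) t := by
      rcases eq_or_ne j i with rfl | hj
      · simpa using hasDerivAt_id' t
      · simpa [hj, pderiv_X_of_ne hj] using hasDerivAt_const t (y j)
    simpa only [pderiv_mul, map_add, map_mul, eval_X] using hp.fun_mul hX

theorem eval_pderiv_eq_zero_of_isLocalMax {σ : Type*} {p : MvPolynomial σ ℝ} {y : σ → ℝ}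
    (h : IsLocalMax (fun x ↦ eval x p) y) (i : σ) : eval y (pderiv i p) = 0 := by
  classical
  have hc : Continuous fun s : ℝ ↦ Function.update y i s := by fun_prop
  have hy : Function.update y i (y i) = y := Function.update_eq_self i y
  have hl : IsLocalMax (fun s ↦ eval (Function.update y i s) p) (y i) := by
    have ht : Filter.Tendsto (fun s : ℝ ↦ Function.update y i s) (nhds (y i)) (nhds y) := by
      simpa only [hy] using hc.tendsto (y i)
    have := ht.eventually h
    simpa only [IsLocalMax, IsMaxFilter, hy] using this
  simpa only [hy] using hl.hasDerivAt_eq_zero (hasDerivAt_eval_update p y i (y i))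

theorem totalDegree_pderiv_le {σ R : Type*} [CommSemiring R] (p : MvPolynomial σ R) (i : σ) :
    (pderiv i p).totalDegree ≤ p.totalDegree - 1 := by
  classical
  rw [totalDegree]
  refine Finset.sup_le fun m hm ↦ ?_
  have hm' : m + Finsupp.single i 1 ∈ p.support := by
    rw [mem_support_iff] at hm ⊢
    intro h
    exact hm (by rw [coeff_pderiv, h]; simp)
  have := le_totalDegree hm'
  rw [Finsupp.sum_add_index' (by simp) (by simp)] at this
  simp only [Finsupp.sum_single_index] at this
  omega

/-- Polynomials take arbitrary prescribed values at finitely many distinct points. -/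
theorem exists_eval_eq {σ ι K : Type*} [Fintype ι] [Field K] {z : ι → σ → K}
    (hz : Function.Injective z) (v : ι → K) : ∃ p : MvPolynomial σ K, ∀ j, eval (z j) p = v j := by
  classical
  have hsep : ∀ a b : ι, ∃ q : MvPolynomial σ K, a ≠ b → eval (z a) q ≠ 0 ∧ eval (z b) q = 0 := by
    intro a b
    by_cases hab : a = b
    · exact ⟨0, fun h ↦ absurd hab h⟩
    obtain ⟨i, hi⟩ := Function.ne_iff.1 (hz.ne hab)
    exact ⟨X i - C (z b i), fun _ ↦ by simp [sub_ne_zero.2 hi]⟩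
  choose q hq using hsep
  let e : ι → MvPolynomial σ K := fun a ↦ ∏ b ∈ Finset.univ.erase a, q a b
  have he : ∀ a, eval (z a) (e a) ≠ 0 := fun a ↦ by
    rw [map_prod]
    exact Finset.prod_ne_zero_iff.2 fun b hb ↦ (hq a b (Finset.ne_of_mem_erase hb).symm).1
  have he' : ∀ a b, a ≠ b → eval (z b) (e a) = 0 := fun a b hab ↦ by
    rw [map_prod]
    exact Finset.prod_eq_zero (Finset.mem_erase.2 ⟨hab.symm, Finset.mem_univ b⟩) (hq a b hab).2
  refine ⟨∑ a, C (v a / eval (z a) (e a)) * e a, fun j ↦ ?_⟩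
  rw [map_sum, Finset.sum_eq_single j (fun a _ ha ↦ by simp [he' a j ha]) (by simp)]
  simp [he j]

/-- A weak Bézout bound: if the `d`-th power of every coordinate agrees, on a finite set of points,
with a polynomial of degree less than `d`, then there are at most `d ^ n` points. -/
theorem card_le_pow_of_pow_eq_eval {σ ι K : Type*} [Fintype σ] [Fintype ι] [Field K]
    {z : ι → σ → K} (hz : Function.Injective z) {d : ℕ} {r : σ → MvPolynomial σ K}
    (hr : ∀ i, (r i).totalDegree < d) (hzr : ∀ j i, z j i ^ d = eval (z j) (r i)) :
    Fintype.card ι ≤ d ^ Fintype.card σ := by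
  classical
  obtain ⟨L, hL⟩ : ∃ L : MvPolynomial σ K →ₗ[K] (ι → K), ∀ p j, L p j = eval (z j) p :=
    ⟨LinearMap.pi fun j ↦ (aeval (z j)).toLinearMap, fun p j ↦ by simp [aeval_eq_eval]⟩
  let b : (σ → Fin d) → (ι → K) := fun a j ↦ ∏ i, z j i ^ (a i : ℕ)
  have key : ∀ n : ℕ, ∀ p : MvPolynomial σ K, p.totalDegree ≤ n →
      L p ∈ Submodule.span K (Set.range b) := by
    intro n
    induction n using Nat.strong_induction_on with
    | _ n ih =>
      intro p hp
      rw [p.as_sum, map_sum]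
      refine Submodule.sum_mem _ fun m hm ↦ ?_
      have hmn : m.sum (fun _ e ↦ e) ≤ n := (le_totalDegree hm).trans hp
      rw [← mul_one (coeff m p), ← smul_eq_mul, ← smul_monomial, map_smul]
      refine Submodule.smul_mem _ _ ?_
      by_cases hmd : ∀ i, m i < d
      · refine Submodule.subset_span ⟨fun i ↦ ⟨m i, hmd i⟩, ?_⟩
        ext j
        simp [hL, b, eval_monomial, Finsupp.prod_fintype]
      · push Not at hmd
        obtain ⟨i, hi⟩ := hmd
        have hsplit : m - Finsupp.single i d + Finsupp.single i d = m :=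
          tsub_add_cancel_of_le (by simpa using hi)
        have hsum : (m - Finsupp.single i d).sum (fun _ e ↦ e) + d = m.sum (fun _ e ↦ e) := by
          conv_rhs => rw [← hsplit]
          rw [Finsupp.sum_add_index' (by simp) (by simp)]
          simp
        have hred : L (monomial m 1) = L (monomial (m - Finsupp.single i d) 1 * r i) := by
          ext j
          rw [hL, hL]
          conv_lhs => rw [← hsplit, ← one_mul (1 : K), ← monomial_mul]
          rw [map_mul, map_mul, ← hzr j i, ← X_pow_eq_monomial]
          simp
        rw [hred]
        have hdeg : (monomial (m - Finsupp.single i d) (1 : K) * r i).totalDegree < n := by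
          refine (totalDegree_mul _ _).trans_lt ?_
          rw [totalDegree_monomial _ one_ne_zero]
          have := hr i
          omega
        exact ih _ hdeg _ le_rfl
  have htop : Submodule.span K (Set.range b) = ⊤ := by
    refine (Submodule.eq_top_iff').2 fun v ↦ ?_
    obtain ⟨p, hp⟩ := exists_eval_eq hz v
    have hpv : L p = v := by ext j; rw [hL, hp]
    rw [← hpv]
    exact key _ p le_rfl
  calc Fintype.card ι = Module.finrank K (ι → K) := (Module.finrank_fintype_fun_eq_card K).symm
    _ = (Set.range b).finrank K := by rw [Set.finrank, htop, finrank_top]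
    _ ≤ Fintype.card (σ → Fin d) := finrank_range_le_card b
    _ = d ^ Fintype.card σ := by simp

/-- Add a small multiple of `∑ xᵢ ^ (d + 1)` to `p`: the resulting polynomial has at most `d ^ n`
critical points. -/
theorem card_le_pow_of_critical {σ ι : Type*} [Fintype σ] [Fintype ι] {z : ι → σ → ℝ}
    (hz : Function.Injective z) {d : ℕ} {p : MvPolynomial σ ℝ} (hd : 0 < d)
    (hp : p.totalDegree ≤ d) {ε : ℝ} (hε : ε ≠ 0)
    (hcrit : ∀ j i, eval (z j) (pderiv i (p + C ε * ∑ k, X k ^ (d + 1))) = 0) :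
    Fintype.card ι ≤ d ^ Fintype.card σ := by
  classical
  have hc : ε * ((d : ℝ) + 1) ≠ 0 := mul_ne_zero hε (by positivity)
  refine card_le_pow_of_pow_eq_eval hz
    (r := fun i ↦ C (-(ε * ((d : ℝ) + 1))⁻¹) * pderiv i p) (fun i ↦ ?_) fun j i ↦ ?_
  · refine (totalDegree_mul _ _).trans_lt ?_
    have := totalDegree_pderiv_le p i
    rw [totalDegree_C]
    omega
  · have h := hcrit j i
    have hs : pderiv i (∑ k, X k ^ (d + 1) : MvPolynomial σ ℝ) = C ((d : ℝ) + 1) * X i ^ d := by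
      rw [map_sum, Finset.sum_eq_single i
        (fun k _ hk ↦ by simp [pderiv_X_of_ne hk]) (by simp)]
      simp
    rw [map_add, pderiv_C_mul, hs] at h
    simp only [map_add, map_mul, eval_C, map_pow, eval_X] at h
    simp only [map_mul, eval_C]
    field_simp
    linear_combination h

/-- Suppose that `p` vanishes at the points of the compact sets `K j` outside their disjoint open
subsets `U j`, and is nonzero somewhere in each `U j`. Then a generic small perturbation of `p` has a
critical point in each `U j`, which bounds the number of these sets. -/
theorem card_le_pow_of_disjoint {σ ι : Type*} [Fintype σ] [Fintype ι] {d : ℕ}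
    {p : MvPolynomial σ ℝ} (hd : 0 < d) (hp : p.totalDegree ≤ d) {U K : ι → Set (σ → ℝ)}
    (hU : ∀ j, IsOpen (U j)) (hK : ∀ j, IsCompact (K j)) (hUK : ∀ j, U j ⊆ K j)
    (hdisj : Pairwise (Function.onFun Disjoint U)) (hzero : ∀ j, ∀ x ∈ K j \ U j, eval x p = 0)
    (hne : ∀ j, ∃ x ∈ U j, eval x p ≠ 0) : Fintype.card ι ≤ d ^ Fintype.card σ := by
  classical
  choose x hxU hx using hne
  let q : MvPolynomial σ ℝ := ∑ k, X k ^ (d + 1)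
  have hbound : ∀ j, ∃ M, ∀ y ∈ K j, |eval y q| ≤ M := fun j ↦ by
    obtain ⟨M, hM⟩ := (hK j).exists_bound_of_continuousOn (continuous_eval q).continuousOn
    exact ⟨M, hM⟩
  choose M hM using hbound
  have hM0 : ∀ j, 0 ≤ M j := fun j ↦ (abs_nonneg _).trans (hM j (x j) (hUK j (hxU j)))
  have hsmall : ∀ j, ∀ᶠ ε in nhdsWithin (0 : ℝ) (Set.Ioi 0), 2 * ε * M j < |eval (x j) p| := by
    intro j
    have ht : Filter.Tendsto (fun ε : ℝ ↦ 2 * ε * M j) (nhds 0) (nhds (2 * 0 * M j)) :=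
      Continuous.tendsto (by fun_prop) 0
    exact (ht.mono_left nhdsWithin_le_nhds).eventually_lt_const (by simpa using hx j)
  obtain ⟨ε, hεM, hε⟩ := ((Filter.eventually_all.2 hsmall).and self_mem_nhdsWithin).exists
  have hε : 0 < ε := hε
  have hcrit : ∀ j, ∃ y ∈ U j, ∀ i, eval y (pderiv i (p + C ε * q)) = 0 := by
    intro j
    obtain ⟨s, hs0, hs, hs'⟩ : ∃ s : ℝ, s ≠ 0 ∧ |s| = 1 ∧ s * eval (x j) p = |eval (x j) p| := by
      rcases le_or_gt 0 (eval (x j) p) with h | h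
      · exact ⟨1, by simp, by simp, by rw [abs_of_nonneg h, one_mul]⟩
      · exact ⟨-1, by simp, by simp, by rw [abs_of_neg h, neg_one_mul]⟩
    have hpert : ∀ y ∈ K j, |s * (ε * eval y q)| ≤ ε * M j := fun y hy ↦ by
      rw [abs_mul, hs, one_mul, abs_mul, abs_of_pos hε]
      exact mul_le_mul_of_nonneg_left (hM j y hy) hε.le
    obtain ⟨y, hyK, hy⟩ := (hK j).exists_isMaxOn ⟨x j, hUK j (hxU j)⟩
      (continuous_eval (C s * (p + C ε * q))).continuousOn
    have hyU : y ∈ U j := by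
      by_contra hyU
      have h1 := hy (hUK j (hxU j))
      simp only [Set.mem_ofPred_eq, map_mul, map_add, eval_C, hzero j y ⟨hyK, hyU⟩] at h1
      have h2 := (abs_le.1 (hpert y hyK)).2
      have h3 := (abs_le.1 (hpert (x j) (hUK j (hxU j)))).1
      have h4 := hεM j
      linarith
    have hloc : IsLocalMax (fun x ↦ eval x (C s * (p + C ε * q))) y :=
      hy.isLocalMax (Filter.mem_of_superset ((hU j).mem_nhds hyU) (hUK j))
    refine ⟨y, hyU, fun i ↦ ?_⟩
    have := eval_pderiv_eq_zero_of_isLocalMax hloc i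
    rw [pderiv_C_mul, map_mul, eval_C] at this
    exact (mul_eq_zero.1 this).resolve_left hs0
  choose z hzU hz using hcrit
  refine card_le_pow_of_critical (z := z) (fun a b hab ↦ ?_) hd hp hε.ne' hz
  by_contra hne
  exact Set.disjoint_left.1 (hdisj hne) (hzU a) (hab ▸ hzU b)

/-- The complement of the zero set of a polynomial of degree at most `D` in `n` variables, if it has
finitely many components, has at most `(D + 2) ^ n` of them. -/
theorem card_connectedComponents_compl_zeros_le {σ : Type*} [Fintype σ] {D : ℕ}
    (p : MvPolynomial σ ℝ) (hp : p.totalDegree ≤ D)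
    [Finite (ConnectedComponents {x : σ → ℝ // eval x p ≠ 0})] :
    Nat.card (ConnectedComponents {x : σ → ℝ // eval x p ≠ 0}) ≤ (D + 2) ^ Fintype.card σ := by
  classical
  have hopen : IsOpen {x : σ → ℝ | eval x p ≠ 0} :=
    isOpen_ne_fun (continuous_eval p) continuous_const
  have : LocallyConnectedSpace {x : σ → ℝ // eval x p ≠ 0} :=
    hopen.isOpenEmbedding_subtypeVal.locallyConnectedSpace
  let ι := ConnectedComponents {x : σ → ℝ // eval x p ≠ 0}
  have : Fintype ι := Fintype.ofFinite _
  let V : ι → Set (σ → ℝ) := fun c ↦ Subtype.val '' (ConnectedComponents.mk ⁻¹' {c})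
  have hVopen : ∀ c, IsOpen (V c) := fun c ↦ by
    obtain ⟨x, rfl⟩ := ConnectedComponents.surjective_coe c
    refine hopen.isOpenMap_subtype_val _ ?_
    rw [connectedComponents_preimage_singleton]
    exact isOpen_connectedComponent (α := {x : σ → ℝ // eval x p ≠ 0})
  have hVdisj : Pairwise (Function.onFun Disjoint V) := by
    rintro a b hab
    refine Set.disjoint_left.2 ?_
    rintro _ ⟨x, hx, rfl⟩ ⟨y, hy, hxy⟩
    obtain rfl := Subtype.ext hxy
    exact hab (Eq.trans (Eq.symm hx) hy)
  have hVcover : ∀ x, eval x p ≠ 0 → ∃ c, x ∈ V c := fun x hx ↦ ⟨_, ⟨x, hx⟩, rfl, rfl⟩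
  have hpt : ∀ c, ∃ x ∈ V c, eval x p ≠ 0 := fun c ↦ by
    obtain ⟨x, rfl⟩ := ConnectedComponents.surjective_coe c
    exact ⟨x, ⟨x, rfl, rfl⟩, x.2⟩
  choose x hxV hx using hpt
  obtain ⟨R, hR⟩ : ∃ R : ℝ, ∀ c, ∑ i, x c i ^ 2 < R := by
    obtain ⟨R, hR⟩ := (Set.finite_range fun c ↦ ∑ i, x c i ^ 2).bddAbove
    exact ⟨R + 1, fun c ↦ (hR ⟨c, rfl⟩).trans_lt (lt_add_one R)⟩
  have hcont : Continuous fun y : σ → ℝ ↦ ∑ i, y i ^ 2 := by fun_prop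
  have hball : IsCompact {y : σ → ℝ | ∑ i, y i ^ 2 ≤ R} := by
    refine (isCompact_closedBall (0 : σ → ℝ) (R + 1)).of_isClosed_subset
      (isClosed_le hcont continuous_const) fun y hy ↦ ?_
    have hy : ∑ i, y i ^ 2 ≤ R := hy
    have hR0 : 0 ≤ R := (Finset.sum_nonneg fun i _ ↦ sq_nonneg (y i)).trans hy
    rw [mem_closedBall_zero_iff, pi_norm_le_iff_of_nonneg (by linarith)]
    intro i
    have := Finset.single_le_sum (fun i _ ↦ sq_nonneg (y i)) (Finset.mem_univ i)
    rw [Real.norm_eq_abs]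
    exact abs_le_of_sq_le_sq (by nlinarith) (by linarith)
  let Q : MvPolynomial σ ℝ := C R - ∑ i, X i ^ 2
  have hQ : ∀ y, eval y Q = R - ∑ i, y i ^ 2 := fun y ↦ by simp [Q]
  have hQdeg : Q.totalDegree ≤ 2 := by
    refine (totalDegree_sub _ _).trans (max_le (by simp) ?_)
    exact (totalDegree_finsetSum _ _).trans (Finset.sup_le fun i _ ↦ by simp)
  rw [Nat.card_eq_fintype_card]
  refine card_le_pow_of_disjoint (p := p * Q) (d := D + 2) (by omega)
    ((totalDegree_mul _ _).trans (add_le_add hp hQdeg))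
    (U := fun c ↦ V c ∩ {y : σ → ℝ | ∑ i, y i ^ 2 < R})
    (K := fun c ↦ {y : σ → ℝ | ∑ i, y i ^ 2 ≤ R} \ ⋃ c' ∈ {c' | c' ≠ c}, V c')
    (fun c ↦ (hVopen c).inter (isOpen_lt hcont continuous_const))
    (fun c ↦ hball.diff (isOpen_biUnion fun c' _ ↦ hVopen c')) ?_ ?_ ?_ ?_
  · rintro c y ⟨hyV, hyR⟩
    have hyR : ∑ i, y i ^ 2 < R := hyR
    refine ⟨hyR.le, ?_⟩
    simp only [Set.mem_iUnion, not_exists]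
    exact fun c' hc' hy ↦ Set.disjoint_left.1 (hVdisj hc') hy hyV
  · exact fun a b hab ↦ (hVdisj hab).mono Set.inter_subset_left Set.inter_subset_left
  · rintro c y ⟨⟨hyR, hyV⟩, hyU⟩
    by_contra hne
    rw [map_mul, hQ] at hne
    obtain ⟨c', hc'⟩ := hVcover y (left_ne_zero_of_mul hne)
    have hcc : c' = c := by
      by_contra hcc
      exact hyV (Set.mem_biUnion hcc hc')
    subst hcc
    exact hyU ⟨hc', lt_of_le_of_ne hyR fun h : ∑ i, y i ^ 2 = R ↦ hne (by simp [h])⟩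
  · refine fun c ↦ ⟨x c, ⟨hxV c, hR c⟩, ?_⟩
    rw [map_mul, hQ]
    exact mul_ne_zero (hx c) (sub_pos.2 (hR c)).ne'

end MvPolynomial


/-- If `P` is a polynomial on `ℝ³` of degree at most `D ≥ 1`, then the number of
connected components of `ℝ³ ∖ Z(P)` is at most `C·D³` for an absolute
constant `C`.  (The integrable function `f` supported in a ball of radius `R`
plays no role in the conclusion, as in the paper's setup.) -/
theorem components_of_polynomial_complement :
    ∃ C : ℕ, 0 < C ∧
      ∀ (f : (Fin 3 → ℝ) → ℂ) (R : ℝ) (x₀ : Fin 3 → ℝ),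
        MeasureTheory.Integrable f →
        (∀ x, f x ≠ 0 → x ∈ Metric.closedBall x₀ R) →
        ∀ (D : ℕ), 1 ≤ D →
        ∀ P : MvPolynomial (Fin 3) ℝ, P.totalDegree ≤ D →
          Nat.card (ConnectedComponents
              {x : Fin 3 → ℝ // MvPolynomial.eval x P ≠ 0})
            ≤ C * D ^ 3 := by
  refine ⟨27, by norm_num, fun _ _ _ _ _ D hD P hP ↦ ?_⟩
  rcases finite_or_infinite
    (ConnectedComponents {x : Fin 3 → ℝ // MvPolynomial.eval x P ≠ 0}) with _ | _
  · calc _ ≤ (D + 2) ^ 3 := by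
          simpa using MvPolynomial.card_connectedComponents_compl_zeros_le P hP
      _ ≤ (3 * D) ^ 3 := Nat.pow_le_pow_left (by omega) 3
      _ = 27 * D ^ 3 := by ring
  · simp
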